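/- Let F be a field of characteristic zero and let L be a semisimple Lie algebra over F of dimension 3. If a ∈ L is a nonzero element with κ(a,a) = 0, where κ is the Killing form of L, then the linear map ad(a) : L → L is nilpotent. -/

import Mathlib

/-- A square matrix of size three whose determinant, trace and trace of the square all vanish
cubes to zero. -/
lemma Matrix.pow_three_eq_zero_of_trace_eq_zero {F : Type*} [Field F] [CharZero F]
    (A : Matrix (Fin 3) (Fin 3) F) (hdet : A.det = 0) (htr : A.trace = 0)
    (htr2 : (A * A).trace = 0) : A ^ 3 = 0 := by
  have h2 : (2 : F) ≠ 0 := two_ne_zero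
  have cayley_hamilton : (2 : F) • A ^ 3 = (2 * A.trace) • (A * A)
      - (A.trace ^ 2 - (A * A).trace) • A + (2 * A.det) • (1 : Matrix (Fin 3) (Fin 3) F) := by
    ext i j
    fin_cases i <;> fin_cases j <;>
      simp [pow_succ, Matrix.mul_apply, Fin.sum_univ_three, Matrix.trace_fin_three,
        Matrix.det_fin_three] <;> ring
  rw [hdet, htr, htr2] at cayley_hamilton
  simpa [h2] using cayley_hamilton

/-- An endomorphism which is skew-adjoint for a nondegenerate bilinear form is traceless. -/
lemma LinearMap.BilinForm.Nondegenerate.trace_eq_zero_of_isSkewAdjoint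
    {F V : Type*} [Field F] [CharZero F] [AddCommGroup V] [Module F V] [FiniteDimensional F V]
    {B : LinearMap.BilinForm F V} (hB : B.Nondegenerate) {T : V →ₗ[F] V}
    (hT : B.IsSkewAdjoint T) : LinearMap.trace F V T = 0 := by
  have conj_eq : (B.toDual hB).conj T = -Module.Dual.transpose (R := F) T := by
    ext f x
    obtain ⟨y, rfl⟩ := (B.toDual hB).surjective f
    simpa [LinearEquiv.conj_apply, LinearMap.BilinForm.toDual_def, Module.Dual.transpose_apply]
      using hT y x
  have h := LinearMap.trace_conj' T (B.toDual hB)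
  rw [conj_eq] at h
  have h_neg : -LinearMap.trace F V T = LinearMap.trace F V T := by
    rw [← LinearMap.trace_transpose' T] at h ⊢
    exact (map_neg (LinearMap.trace F (Module.Dual F V)) (Module.Dual.transpose T)).symm.trans h
  exact self_eq_neg.mp h_neg.symm

/-- Let `F` be a field of characteristic zero and `L` a semisimple
Lie algebra over `F` of dimension 3 (semisimplicity expressed via nondegeneracy of the
Killing form, `LieAlgebra.IsKilling`).  If `a ∈ L` is nonzero and isotropic for the
Killing form, i.e. `κ(a, a) = 0`, then `ad(a) : L → L` is nilpotent. -/
theorem ad_nilpotent_of_killing_isotropic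
    (F : Type*) [Field F] [CharZero F]
    (L : Type*) [LieRing L] [LieAlgebra F L] [Module.Finite F L]
    [LieAlgebra.IsKilling F L]
    (hdim : Module.finrank F L = 3)
    (a : L) (ha : a ≠ 0) (hk : killingForm F L a a = 0) :
    IsNilpotent (LieAlgebra.ad F L a) := by
  set T : L →ₗ[F] L := LieAlgebra.ad F L a with hT
  have htr : LinearMap.trace F L T = 0 :=
    (LieAlgebra.IsKilling.killingForm_nondegenerate F L).trace_eq_zero_of_isSkewAdjoint
      fun x y ↦ by
        rw [Pi.neg_apply, map_neg]
        exact LieModule.traceForm_apply_lie_apply' F L L a x y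
  have hdet : LinearMap.det T = 0 :=
    LinearMap.det_eq_zero_iff_ker_ne_bot.mpr fun h ↦
      ha (LinearMap.ker_eq_bot'.mp h a (by simp [hT]))
  have htr2 : LinearMap.trace F L (T * T) = 0 := hk
  let b := Module.finBasisOfFinrankEq F L hdim
  refine ⟨3, (LinearMap.toMatrix b b).injective ?_⟩
  rw [← LinearMap.toMatrix_pow, map_zero]
  apply Matrix.pow_three_eq_zero_of_trace_eq_zero
  · rw [LinearMap.det_toMatrix, hdet]
  · rw [← LinearMap.trace_eq_matrix_trace F b, htr]
  · rw [← LinearMap.toMatrix_mul, ← LinearMap.trace_eq_matrix_trace F b, htr2]
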